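/- arXiv:2212.08422 — 3 statements merged into one kernel-verified Lean document; each statement's English description precedes it below -/
import Mathlib

section
/- Let d ≥ 0 and let A, B be (d+1)-element subsets of the positive integers with A ≀ B, and set H = A ∪ B (so H has 2d+2 elements). Consider the (2d+1)-simplex |H|_{2d+1} ⊆ ℝ^{2d+1}. For each c ∈ H, the facet |H ∖ {c}|_{2d+1} is a lower facet of |H|_{2d+1} if and only if c ∈ B, and an upper facet if and only if c ∈ A. Consequently, the intersection of all lower facets of |H|_{2d+1} equals |A|_{2d+1} and the intersection of all upper facets equals |B|_{2d+1}. -/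
open Finset

noncomputable section

/-- The moment curve `p_δ(t) = (t, t², …, t^δ)` in `ℝ^δ`. -/
def momCurve (δ : ℕ) (t : ℝ) : Fin δ → ℝ := fun i => t ^ (i.1 + 1)

/-- The points `p_δ(a)` on the moment curve for `a` ranging over a finite set of naturals. -/
def momPts (δ : ℕ) (A : Finset ℕ) : Set (Fin δ → ℝ) :=
  (fun a : ℕ => momCurve δ (a : ℝ)) '' (A : Set ℕ)

/-- The simplex `|A|_δ`, i.e. the convex hull of the points `p_δ(a)`, `a ∈ A`. -/
def smp (δ : ℕ) (A : Finset ℕ) : Set (Fin δ → ℝ) := convexHull ℝ (momPts δ A)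

/-- The cyclic polytope `C(m, δ) = conv{p_δ(1), …, p_δ(m)}`. -/
def cyc (m δ : ℕ) : Set (Fin δ → ℝ) := smp δ (Finset.Icc 1 m)

/-- The last standard basis vector `e_δ` of `ℝ^δ`. -/
def eLast (δ : ℕ) : Fin δ → ℝ := fun i => if i.1 = δ - 1 then 1 else 0

/-- The last coordinate of a point of `ℝ^δ`. -/
def lastCoord {δ : ℕ} (x : Fin δ → ℝ) : ℝ :=
  if h : 0 < δ then x ⟨δ - 1, Nat.sub_lt h one_pos⟩ else 0

/-- `x` lies strictly above `V`: `x - r • e_δ ∈ V` for some `r > 0`. -/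
def StrictlyAbove {δ : ℕ} (x : Fin δ → ℝ) (V : Set (Fin δ → ℝ)) : Prop :=
  ∃ r : ℝ, 0 < r ∧ x - r • eLast δ ∈ V

/-- `x` lies strictly below `V`: `x - r • e_δ ∈ V` for some `r < 0`. -/
def StrictlyBelow {δ : ℕ} (x : Fin δ → ℝ) (V : Set (Fin δ → ℝ)) : Prop :=
  ∃ r : ℝ, r < 0 ∧ x - r • eLast δ ∈ V

/-- `|F|_δ` is a lower facet of the cyclic polytope `C(m, δ)`. -/
def IsLowerFacet (m δ : ℕ) (F : Finset ℕ) : Prop :=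
  F ⊆ Finset.Icc 1 m ∧ F.card = δ ∧
    ∀ i ∈ Finset.Icc 1 m, i ∉ F →
      StrictlyAbove (momCurve δ (i : ℝ))
        ((affineSpan ℝ (momPts δ F) : AffineSubspace ℝ (Fin δ → ℝ)) : Set (Fin δ → ℝ))

/-- `|F|_δ` is an upper facet of the cyclic polytope `C(m, δ)`. -/
def IsUpperFacet (m δ : ℕ) (F : Finset ℕ) : Prop :=
  F ⊆ Finset.Icc 1 m ∧ F.card = δ ∧
    ∀ i ∈ Finset.Icc 1 m, i ∉ F →
      StrictlyBelow (momCurve δ (i : ℝ))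
        ((affineSpan ℝ (momPts δ F) : AffineSubspace ℝ (Fin δ → ℝ)) : Set (Fin δ → ℝ))

/-- The facet `|H ∖ {c}|_δ` of the simplex `|H|_δ` is a lower facet of `|H|_δ`. -/
def IsLowerFacetOfSimplex (δ : ℕ) (H : Finset ℕ) (c : ℕ) : Prop :=
  c ∈ H ∧ StrictlyAbove (momCurve δ (c : ℝ))
    ((affineSpan ℝ (momPts δ (H.erase c)) : AffineSubspace ℝ (Fin δ → ℝ)) : Set (Fin δ → ℝ))

/-- The facet `|H ∖ {c}|_δ` of the simplex `|H|_δ` is an upper facet of `|H|_δ`. -/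
def IsUpperFacetOfSimplex (δ : ℕ) (H : Finset ℕ) (c : ℕ) : Prop :=
  c ∈ H ∧ StrictlyBelow (momCurve δ (c : ℝ))
    ((affineSpan ℝ (momPts δ (H.erase c)) : AffineSubspace ℝ (Fin δ → ℝ)) : Set (Fin δ → ℝ))

/-- `T` is a triangulation of the cyclic polytope `C(m, δ)`. -/
def IsTriangulation (m δ : ℕ) (T : Finset (Finset ℕ)) : Prop :=
  (∀ S ∈ T, S ⊆ Finset.Icc 1 m ∧ S.card = δ + 1) ∧
  (⋃ S ∈ T, smp δ S) = cyc m δ ∧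
  ∀ S ∈ T, ∀ S' ∈ T, smp δ S ∩ smp δ S' = smp δ (S ∩ S')

/-- `A` is a face of the triangulation `T`. -/
def IsFace (T : Finset (Finset ℕ)) (A : Finset ℕ) : Prop := ∃ S ∈ T, A ⊆ S

/-- `A ≀ B`: writing `A = {a_0 < … < a_d}` and `B = {b_0 < … < b_d}`, we have
`a_0 < b_0 < a_1 < b_1 < … < a_d < b_d`. -/
def Intertwines (d : ℕ) (A B : Finset ℕ) : Prop :=
  ∃ a b : Fin (d + 1) → ℕ, StrictMono a ∧ StrictMono b ∧
    A = Finset.image a Finset.univ ∧ B = Finset.image b Finset.univ ∧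
    (∀ i, a i < b i) ∧ ∀ i : Fin d, b i.castSucc < a i.succ

/-- `y = ℓ_S(x)` is the lift of `x ∈ |S|_δ` to `ℝ^{δ+1}` given by the barycentric
coordinates of `x` with respect to the vertices of `|S|_δ`. -/
def IsLift (δ : ℕ) (S : Finset ℕ) (x : Fin δ → ℝ) (y : Fin (δ + 1) → ℝ) : Prop :=
  ∃ w : ℕ → ℝ, (∀ a ∈ S, 0 ≤ w a) ∧ (∑ a ∈ S, w a) = 1 ∧
    (∑ a ∈ S, w a • momCurve δ (a : ℝ)) = x ∧
    (∑ a ∈ S, w a • momCurve (δ + 1) (a : ℝ)) = y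

/-- `|A|_δ` is submerged by the triangulation `T`. -/
def Submerged (δ : ℕ) (T : Finset (Finset ℕ)) (A : Finset ℕ) : Prop :=
  ∀ S ∈ T, ∀ x ∈ smp δ A ∩ smp δ S, ∀ y y' : Fin (δ + 1) → ℝ,
    IsLift δ A x y → IsLift δ S x y' → lastCoord y ≤ lastCoord y'

/-- `|A|_δ` is supermerged by the triangulation `T`. -/
def Supermerged (δ : ℕ) (T : Finset (Finset ℕ)) (A : Finset ℕ) : Prop :=
  ∀ S ∈ T, ∀ x ∈ smp δ A ∩ smp δ S, ∀ y y' : Fin (δ + 1) → ℝ,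
    IsLift δ A x y → IsLift δ S x y' → lastCoord y' ≤ lastCoord y

/-- The second higher Stasheff–Tamari order `T ≤₂ T'`. -/
def HST2 (δ : ℕ) (T T' : Finset (Finset ℕ)) : Prop :=
  ∀ S ∈ T, ∀ S' ∈ T', ∀ x ∈ smp δ S ∩ smp δ S', ∀ y y' : Fin (δ + 1) → ℝ,
    IsLift δ S x y → IsLift δ S' x y' → lastCoord y ≤ lastCoord y'

open scoped Classical in
/-- The lower triangulation of `C(m, δ)`: the collection of `(δ+1)`-element subsets `F` of
`{1, …, m}` such that `|F|_{δ+1}` is a lower facet of `C(m, δ+1)`. -/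
def lowerTriang (m δ : ℕ) : Finset (Finset ℕ) :=
  (Finset.Icc 1 m).powerset.filter (fun F => IsLowerFacet m (δ + 1) F)

open scoped Classical in
/-- The upper triangulation of `C(m, δ)`. -/
def upperTriang (m δ : ℕ) : Finset (Finset ℕ) :=
  (Finset.Icc 1 m).powerset.filter (fun F => IsUpperFacet m (δ + 1) F)

open scoped Classical in
/-- `L(H)`: the `(δ+1)`-element subsets `G` of `H` with `|G|_{δ+1}` a lower facet of the
simplex `|H|_{δ+1}`. -/
def LH (δ : ℕ) (H : Finset ℕ) : Finset (Finset ℕ) :=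
  (H.filter (fun c => IsLowerFacetOfSimplex (δ + 1) H c)).image (fun c => H.erase c)

open scoped Classical in
/-- `U(H)`: the `(δ+1)`-element subsets `G` of `H` with `|G|_{δ+1}` an upper facet of the
simplex `|H|_{δ+1}`. -/
def UH (δ : ℕ) (H : Finset ℕ) : Finset (Finset ℕ) :=
  (H.filter (fun c => IsUpperFacetOfSimplex (δ + 1) H c)).image (fun c => H.erase c)

/-- The affine functional on `ℝ^δ` whose value at `p_δ(t)` is `P(t)`, for `P` of degree at most
`δ`. -/
def polyFunctional (δ : ℕ) (P : Polynomial ℝ) : (Fin δ → ℝ) →ᵃ[ℝ] ℝ :=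
  AffineMap.const ℝ _ (P.coeff 0) +
    (∑ i : Fin δ, P.coeff (i.1 + 1) • LinearMap.proj (R := ℝ) (φ := fun _ => ℝ) i).toAffineMap

theorem polyFunctional_apply (δ : ℕ) (P : Polynomial ℝ) (x : Fin δ → ℝ) :
    polyFunctional δ P x = P.coeff 0 + ∑ i : Fin δ, P.coeff (i.1 + 1) * x i := by
  simp [polyFunctional]

theorem polyFunctional_momCurve {δ : ℕ} {P : Polynomial ℝ} (hP : P.natDegree ≤ δ) (t : ℝ) :
    polyFunctional δ P (momCurve δ t) = P.eval t := by
  rw [polyFunctional_apply, Polynomial.eval_eq_sum_range' (Nat.lt_succ_of_le hP),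
    Finset.sum_range_succ', add_comm, Finset.sum_range]
  simp [momCurve]

theorem polyFunctional_eq_zero_of_mem_affineSpan {δ : ℕ} {P : Polynomial ℝ}
    (hP : P.natDegree ≤ δ) {F : Finset ℕ} (hF : ∀ a ∈ F, P.eval (a : ℝ) = 0) {x : Fin δ → ℝ}
    (hx : x ∈ affineSpan ℝ (momPts δ F)) : polyFunctional δ P x = 0 := by
  refine affineSpan_induction (p := fun y => polyFunctional δ P y = 0) hx ?_ ?_
  · rintro _ ⟨a, ha, rfl⟩
    exact (polyFunctional_momCurve hP _).trans (hF a ha)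
  · intro c u v w hu hv hw
    have h : (polyFunctional δ P).linear (u -ᵥ v) = 0 := by
      rw [AffineMap.linearMap_vsub, hu, hv, vsub_self]
    rw [AffineMap.map_vadd, map_smul, h, hw, smul_zero, vadd_eq_add, add_zero]

theorem polyFunctional_sub_smul_eLast (n : ℕ) (P : Polynomial ℝ) (x : Fin (n + 1) → ℝ) (r : ℝ) :
    polyFunctional (n + 1) P (x - r • eLast (n + 1)) =
      polyFunctional (n + 1) P x - r * P.coeff (n + 1) := by
  have h : ∑ i : Fin (n + 1), P.coeff (i.1 + 1) * (r * eLast (n + 1) i) =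
      r * P.coeff (n + 1) := by
    rw [Finset.sum_eq_single (Fin.last n)]
    · simp [eLast, mul_comm]
    · intro i _ hi
      have : i.1 ≠ n := fun h => hi (Fin.ext h)
      simp [eLast, this]
    · simp
  simp only [polyFunctional_apply, Pi.sub_apply, Pi.smul_apply, smul_eq_mul, mul_sub,
    Finset.sum_sub_distrib, h]
  ring

theorem sum_eval_basis_smul_momCurve {n : ℕ} {F : Finset ℕ} (hF : F.card = n + 1) (t : ℝ) :
    ∑ a ∈ F, (Lagrange.basis F (fun a : ℕ => (a : ℝ)) a).eval t • momCurve (n + 1) (a : ℝ) =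
      momCurve (n + 1) t - (∏ a ∈ F, (t - (a : ℝ))) • eLast (n + 1) := by
  have hinj : Set.InjOn (fun a : ℕ => (a : ℝ)) (F : Set ℕ) := Nat.cast_injective.injOn
  have key : ∀ Q : Polynomial ℝ, Q.degree < F.card →
      ∑ a ∈ F, (Lagrange.basis F (fun a : ℕ => (a : ℝ)) a).eval t * Q.eval (a : ℝ) =
        Q.eval t := by
    intro Q hQ
    conv_rhs => rw [Lagrange.eq_interpolate hinj hQ, Lagrange.interpolate_apply,
      Polynomial.eval_finsetSum]
    exact Finset.sum_congr rfl fun a _ => by simp [mul_comm]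
  ext i
  simp only [Finset.sum_apply, Pi.smul_apply, Pi.sub_apply, smul_eq_mul, momCurve, eLast]
  by_cases hi : i.1 = n
  · have hdeg : (Polynomial.X ^ (n + 1) -
        Lagrange.nodal F (fun a : ℕ => (a : ℝ))).degree < (F.card : WithBot ℕ) := by
      have h := Polynomial.degree_sub_lt_left (p := (Polynomial.X : Polynomial ℝ) ^ (n + 1))
        (q := Lagrange.nodal F (fun a : ℕ => (a : ℝ)))
        (by rw [Polynomial.degree_X_pow, Lagrange.degree_nodal, hF])
        (pow_ne_zero _ Polynomial.X_ne_zero)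
        (by rw [(Polynomial.monic_X_pow _).leadingCoeff, Lagrange.nodal_monic.leadingCoeff])
      rw [Polynomial.degree_X_pow] at h
      rwa [hF]
    have h := key _ hdeg
    rw [Polynomial.eval_sub, Lagrange.eval_nodal] at h
    simp only [hi, Nat.add_sub_cancel, if_true, mul_one]
    rw [Polynomial.eval_pow, Polynomial.eval_X] at h
    rw [← h]
    refine Finset.sum_congr rfl fun a ha => ?_
    rw [Polynomial.eval_sub, Lagrange.eval_nodal_at_node (v := fun a : ℕ => (a : ℝ)) ha]
    simp
  · have h := key (Polynomial.X ^ (i.1 + 1)) (by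
      rw [Polynomial.degree_X_pow, hF]
      exact_mod_cast (by omega : i.1 + 1 < n + 1))
    simpa [hi] using h

/-- The vertical line through `p_δ(t)` meets the hyperplane spanned by `δ` points of the moment
curve only at height `∏ (t - a)` below `p_δ(t)`. -/
theorem momCurve_sub_smul_mem_affineSpan_iff {n : ℕ} {F : Finset ℕ} (hF : F.card = n + 1)
    (t r : ℝ) :
    momCurve (n + 1) t - r • eLast (n + 1) ∈ affineSpan ℝ (momPts (n + 1) F) ↔
      r = ∏ a ∈ F, (t - (a : ℝ)) := by
  constructor
  · intro h
    have hdeg : (Lagrange.nodal F (fun a : ℕ => (a : ℝ))).natDegree = n + 1 := by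
      rw [Lagrange.natDegree_nodal, hF]
    have h0 := polyFunctional_eq_zero_of_mem_affineSpan hdeg.le
      (fun a ha => Lagrange.eval_nodal_at_node (v := fun a : ℕ => (a : ℝ)) ha) h
    have hlead : (Lagrange.nodal F (fun a : ℕ => (a : ℝ))).coeff (n + 1) = 1 := by
      rw [← hdeg]; exact Lagrange.nodal_monic
    rw [polyFunctional_sub_smul_eLast, polyFunctional_momCurve hdeg.le, Lagrange.eval_nodal,
      hlead] at h0
    linarith
  · rintro rfl
    rw [← sum_eval_basis_smul_momCurve hF]
    have hsum : ∑ a ∈ F, (Lagrange.basis F (fun a : ℕ => (a : ℝ)) a).eval t = 1 := by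
      rw [← Polynomial.eval_finsetSum, Lagrange.sum_basis Nat.cast_injective.injOn
        (Finset.card_pos.1 (by omega)), Polynomial.eval_one]
    rw [← Finset.affineCombination_eq_linear_combination _ _ _ hsum]
    exact affineCombination_mem_affineSpan_image hsum (fun a ha hn => absurd ha hn) _

theorem strictlyAbove_affineSpan_iff {n : ℕ} {F : Finset ℕ} (hF : F.card = n + 1) (t : ℝ) :
    StrictlyAbove (momCurve (n + 1) t) (affineSpan ℝ (momPts (n + 1) F) : Set _) ↔
      0 < ∏ a ∈ F, (t - (a : ℝ)) := by
  simp [StrictlyAbove, momCurve_sub_smul_mem_affineSpan_iff hF]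

theorem strictlyBelow_affineSpan_iff {n : ℕ} {F : Finset ℕ} (hF : F.card = n + 1) (t : ℝ) :
    StrictlyBelow (momCurve (n + 1) t) (affineSpan ℝ (momPts (n + 1) F) : Set _) ↔
      ∏ a ∈ F, (t - (a : ℝ)) < 0 := by
  simp [StrictlyBelow, momCurve_sub_smul_mem_affineSpan_iff hF]

theorem smp_mono (δ : ℕ) {A B : Finset ℕ} (h : A ⊆ B) : smp δ A ⊆ smp δ B :=
  convexHull_mono (Set.image_mono (Finset.coe_subset.2 h))

theorem momCurve_natCast_injective (n : ℕ) :
    Function.Injective fun a : ℕ => momCurve (n + 1) (a : ℝ) := by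
  intro a b h
  simpa [momCurve] using congrFun h 0

theorem exists_weights_of_mem_smp {n : ℕ} {A : Finset ℕ} {x : Fin (n + 1) → ℝ}
    (hx : x ∈ smp (n + 1) A) :
    ∃ w : ℕ → ℝ, (∀ a ∈ A, 0 ≤ w a) ∧ ∑ a ∈ A, w a = 1 ∧
      ∑ a ∈ A, w a • momCurve (n + 1) (a : ℝ) = x := by
  classical
  rw [smp, momPts, ← Finset.coe_image, Finset.mem_convexHull'] at hx
  obtain ⟨w, h0, h1, h2⟩ := hx
  have hinj := (momCurve_natCast_injective n).injOn (s := (A : Set ℕ))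
  rw [Finset.sum_image hinj] at h1 h2
  exact ⟨fun a => w (momCurve (n + 1) (a : ℝ)),
    fun a ha => h0 _ (Finset.mem_image_of_mem _ ha), h1, h2⟩

/-- In a simplex, a face is the intersection of the facets opposite the vertices outside it. -/
theorem iInter_smp_erase {n : ℕ} {H C : Finset ℕ} (hH : H.card ≤ n + 2) (hC : C ⊆ H)
    (hne : C.Nonempty) :
    ⋂ c ∈ C, smp (n + 1) (H.erase c) = smp (n + 1) (H \ C) := by
  refine Set.Subset.antisymm (fun x hx => ?_) (Set.subset_iInter₂ fun c hc => smp_mono _ ?_)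
  · rw [Set.mem_iInter₂] at hx
    obtain ⟨c₀, hc₀⟩ := hne
    obtain ⟨w, h0, h1, h2⟩ :=
      exists_weights_of_mem_smp (smp_mono _ (Finset.erase_subset c₀ H) (hx c₀ hc₀))
    have hw : ∀ c ∈ C, w c = 0 := by
      intro c hc
      have hinj : Set.InjOn (fun a : ℕ => (a : ℝ)) (H : Set ℕ) := Nat.cast_injective.injOn
      have hdeg : (Lagrange.basis H (fun a : ℕ => (a : ℝ)) c).natDegree ≤ n + 1 := by
        rw [Lagrange.natDegree_basis hinj (hC hc)]
        omega
      have hx0 := polyFunctional_eq_zero_of_mem_affineSpan hdeg (F := H.erase c)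
        (fun a ha => Lagrange.eval_basis_of_ne (v := fun a : ℕ => (a : ℝ))
          (Finset.ne_of_mem_erase ha).symm (Finset.mem_of_mem_erase ha))
        (convexHull_subset_affineSpan _ (hx c hc))
      rw [← h2, ← Finset.affineCombination_eq_linear_combination _ _ _ h1,
        Finset.map_affineCombination _ _ _ h1,
        Finset.affineCombination_eq_linear_combination _ _ _ h1,
        Finset.sum_eq_single_of_mem c (hC hc)] at hx0
      · simpa [polyFunctional_momCurve hdeg, Lagrange.eval_basis_self hinj (hC hc)] using hx0
      · intro a ha hac
        simp [polyFunctional_momCurve hdeg,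
          Lagrange.eval_basis_of_ne (v := fun a : ℕ => (a : ℝ)) hac.symm ha]
    have hz : ∀ a ∈ H, a ∉ H \ C → w a = 0 := fun a ha hn =>
      hw a (by simpa [ha] using hn)
    rw [← Finset.sum_subset Finset.sdiff_subset hz] at h1
    rw [← Finset.sum_subset Finset.sdiff_subset
      fun a ha hn => by rw [hz a ha hn, zero_smul]] at h2
    rw [← h2]
    exact (convex_convexHull ℝ _).sum_mem (fun a ha => h0 a (Finset.sdiff_subset ha)) h1
      fun a ha => subset_convexHull ℝ _ ⟨a, ha, rfl⟩
  · intro a ha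
    rw [Finset.mem_sdiff] at ha
    exact Finset.mem_erase.2 ⟨fun h => ha.2 (h ▸ hc), ha.1⟩

theorem lt_of_castSucc_lt_succ {d : ℕ} {a b : Fin (d + 1) → ℕ} (hb : Monotone b)
    (hba : ∀ i : Fin d, b i.castSucc < a i.succ) (i j : Fin (d + 1)) (hij : i < j) : b i < a j := by
  obtain ⟨k, rfl⟩ := Fin.exists_succ_eq.2 (Fin.ne_zero_of_lt hij)
  exact (hb (Fin.le_castSucc_iff.2 hij)).trans_lt (hba k)

theorem Intertwines.disjoint {d : ℕ} {A B : Finset ℕ} (h : Intertwines d A B) : Disjoint A B := by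
  obtain ⟨a, b, ha, hb, rfl, rfl, hab, hba⟩ := h
  have hlt := lt_of_castSucc_lt_succ hb.monotone hba
  rw [Finset.disjoint_left]
  simp only [Finset.mem_image, Finset.mem_univ, true_and]
  rintro _ ⟨i, rfl⟩ ⟨j, hj⟩
  rcases lt_or_ge j i with h | h
  · exact (hlt j i h).ne hj
  · exact ((hab i).trans_le (hb.monotone h)).ne' hj

/-- Splitting the product of differences from `u i` over the union of the images of `u` and `v`. -/
theorem prod_erase_image_union_image {m : ℕ} {u v : Fin m → ℕ} (hu : Function.Injective u)
    (hv : Function.Injective v) (huv : ∀ i j, u i ≠ v j) (i : Fin m) :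
    ∏ g ∈ (Finset.image u Finset.univ ∪ Finset.image v Finset.univ).erase (u i),
        ((u i : ℝ) - (g : ℝ)) =
      ((u i : ℝ) - v i) *
        ∏ j ∈ Finset.univ.erase i, (((u i : ℝ) - u j) * ((u i : ℝ) - v j)) := by
  have h : (Finset.image u Finset.univ ∪ Finset.image v Finset.univ).erase (u i) =
      (Finset.univ.erase i).image u ∪ Finset.univ.image v := by
    rw [Finset.erase_union_distrib, Finset.image_erase hu, Finset.erase_eq_of_notMem (a := u i)
      (s := Finset.image v Finset.univ) (by simpa using fun j => (huv i j).symm)]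
  rw [h, Finset.prod_union, Finset.prod_image hu.injOn, Finset.prod_image hv.injOn,
    ← Finset.mul_prod_erase Finset.univ (fun j => (u i : ℝ) - v j) (Finset.mem_univ i),
    Finset.prod_mul_distrib]
  · ring
  · rw [Finset.disjoint_left]
    simp only [Finset.mem_image, Finset.mem_univ, true_and]
    rintro _ ⟨j, _, rfl⟩ ⟨k, hk⟩
    exact huv j k hk.symm

theorem Intertwines.prod_sub_neg_and_pos {d : ℕ} {A B : Finset ℕ} (h : Intertwines d A B) :
    (∀ c ∈ A, ∏ g ∈ (A ∪ B).erase c, ((c : ℝ) - (g : ℝ)) < 0) ∧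
      ∀ c ∈ B, 0 < ∏ g ∈ (A ∪ B).erase c, ((c : ℝ) - (g : ℝ)) := by
  have hdisj := h.disjoint
  obtain ⟨a, b, ha, hb, rfl, rfl, hab, hba⟩ := h
  have hlt := lt_of_castSucc_lt_succ hb.monotone hba
  have hne : ∀ i j, a i ≠ b j := fun i j hij =>
    Finset.disjoint_left.1 hdisj (Finset.mem_image_of_mem a (Finset.mem_univ i))
      (hij ▸ Finset.mem_image_of_mem b (Finset.mem_univ j))
  constructor
  · intro c hc
    obtain ⟨i, -, rfl⟩ := Finset.mem_image.1 hc
    rw [prod_erase_image_union_image ha.injective hb.injective hne]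
    refine mul_neg_of_neg_of_pos (sub_neg.2 (Nat.cast_lt.2 (hab i)))
      (Finset.prod_pos fun j hj => ?_)
    rcases lt_or_gt_of_ne (Finset.ne_of_mem_erase hj) with hji | hij
    · exact mul_pos (sub_pos.2 (Nat.cast_lt.2 (ha hji))) (sub_pos.2 (Nat.cast_lt.2 (hlt j i hji)))
    · exact mul_pos_of_neg_of_neg (sub_neg.2 (Nat.cast_lt.2 (ha hij)))
        (sub_neg.2 (Nat.cast_lt.2 ((ha hij).trans (hab j))))
  · intro c hc
    obtain ⟨i, -, rfl⟩ := Finset.mem_image.1 hc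
    rw [Finset.union_comm, prod_erase_image_union_image hb.injective ha.injective
      fun i j => (hne j i).symm]
    refine mul_pos (sub_pos.2 (Nat.cast_lt.2 (hab i))) (Finset.prod_pos fun j hj => ?_)
    rcases lt_or_gt_of_ne (Finset.ne_of_mem_erase hj) with hji | hij
    · exact mul_pos (sub_pos.2 (Nat.cast_lt.2 (hb hji)))
        (sub_pos.2 (Nat.cast_lt.2 ((hab j).trans (hb hji))))
    · exact mul_pos_of_neg_of_neg (sub_neg.2 (Nat.cast_lt.2 (hb hij)))
        (sub_neg.2 (Nat.cast_lt.2 (hlt i j hij)))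

/-- for `A ≀ B` and `H = A ∪ B`, the lower facets of the `(2d+1)`-simplex
`|H|_{2d+1}` are exactly those opposite the vertices of `B`, the upper facets are exactly
those opposite the vertices of `A`, the intersection of all lower facets is `|A|_{2d+1}`,
and the intersection of all upper facets is `|B|_{2d+1}`. -/
theorem statement1 (d : ℕ) (A B : Finset ℕ)
    (hA1 : ∀ a ∈ A, 1 ≤ a) (hB1 : ∀ b ∈ B, 1 ≤ b)
    (hAc : A.card = d + 1) (hBc : B.card = d + 1)
    (hAB : Intertwines d A B) :
    (∀ c ∈ A ∪ B,
      (IsLowerFacetOfSimplex (2 * d + 1) (A ∪ B) c ↔ c ∈ B) ∧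
      (IsUpperFacetOfSimplex (2 * d + 1) (A ∪ B) c ↔ c ∈ A)) ∧
    (⋂ c ∈ (A ∪ B : Finset ℕ), ⋂ (_ : IsLowerFacetOfSimplex (2 * d + 1) (A ∪ B) c),
        smp (2 * d + 1) ((A ∪ B).erase c)) = smp (2 * d + 1) A ∧
    (⋂ c ∈ (A ∪ B : Finset ℕ), ⋂ (_ : IsUpperFacetOfSimplex (2 * d + 1) (A ∪ B) c),
        smp (2 * d + 1) ((A ∪ B).erase c)) = smp (2 * d + 1) B := by
  have hdisj := hAB.disjoint
  obtain ⟨hneg, hpos⟩ := hAB.prod_sub_neg_and_pos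
  have hcard : (A ∪ B).card = 2 * d + 2 := by
    rw [Finset.card_union_of_disjoint hdisj]
    omega
  have herase : ∀ c ∈ A ∪ B, ((A ∪ B).erase c).card = 2 * d + 1 := fun c hc => by
    rw [Finset.card_erase_of_mem hc, hcard]
    rfl
  have hlow : ∀ c ∈ A ∪ B, (IsLowerFacetOfSimplex (2 * d + 1) (A ∪ B) c ↔ c ∈ B) := by
    intro c hc
    rw [IsLowerFacetOfSimplex, strictlyAbove_affineSpan_iff (herase c hc)]
    refine ⟨fun h => (Finset.mem_union.1 hc).resolve_left fun hA => ?_, fun h => ⟨hc, hpos c h⟩⟩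
    exact (hneg c hA).not_gt h.2
  have hup : ∀ c ∈ A ∪ B, (IsUpperFacetOfSimplex (2 * d + 1) (A ∪ B) c ↔ c ∈ A) := by
    intro c hc
    rw [IsUpperFacetOfSimplex, strictlyBelow_affineSpan_iff (herase c hc)]
    refine ⟨fun h => (Finset.mem_union.1 hc).resolve_right fun hB => ?_, fun h => ⟨hc, hneg c h⟩⟩
    exact (hpos c hB).not_gt h.2
  refine ⟨fun c hc => ⟨hlow c hc, hup c hc⟩, ?_, ?_⟩
  · have h := iInter_smp_erase hcard.le Finset.subset_union_right
      (Finset.card_pos.1 (by omega : 0 < B.card))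
    rw [Finset.union_sdiff_cancel_right hdisj] at h
    rw [← h]
    ext x
    simp only [Set.mem_iInter]
    exact ⟨fun hx c hc => hx c (Finset.mem_union_right A hc)
      ((hlow c (Finset.mem_union_right A hc)).2 hc), fun hx c hc hl => hx c ((hlow c hc).1 hl)⟩
  · have h := iInter_smp_erase hcard.le Finset.subset_union_left
      (Finset.card_pos.1 (by omega : 0 < A.card))
    rw [Finset.union_sdiff_cancel_left hdisj] at h
    rw [← h]
    ext x
    simp only [Set.mem_iInter]
    exact ⟨fun hx c hc => hx c (Finset.mem_union_left B hc)
      ((hup c (Finset.mem_union_left B hc)).2 hc), fun hx c hc hl => hx c ((hup c hc).1 hl)⟩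
end
end

section
/- Let d ≥ 1 and m ≥ 2d+1 be integers and let A = {a_0 < a_1 < … < a_d} be a (d+1)-element subset of {1, …, m}. Then the d-simplex |A|_{2d} is contained in no lower facet of the cyclic polytope C(m, 2d) if and only if a_{i+1} ≥ a_i + 2 for all 0 ≤ i ≤ d−1. -/
open Finset

noncomputable section

/-- The affine functional on `ℝ^δ` whose value at `p_δ(t)` is `P(t)`. -/
def momFunctional (δ : ℕ) (P : Polynomial ℝ) (x : Fin δ → ℝ) : ℝ :=
  P.coeff 0 + ∑ i : Fin δ, P.coeff (i.1 + 1) * x i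

lemma momFunctional_momCurve {δ : ℕ} {P : Polynomial ℝ} (hP : P.natDegree ≤ δ) (t : ℝ) :
    momFunctional δ P (momCurve δ t) = P.eval t := by
  rw [Polynomial.eval_eq_sum_range' (Nat.lt_succ_of_le hP), Finset.sum_range_succ', momFunctional,
    ← Fin.sum_univ_eq_sum_range (fun i => P.coeff (i + 1) * t ^ (i + 1))]
  simp [momCurve, add_comm]

lemma momFunctional_add_smul_sub {δ : ℕ} (P : Polynomial ℝ) (r : ℝ) (u v w : Fin δ → ℝ) :
    momFunctional δ P (r • (u - v) + w) =
      r * (momFunctional δ P u - momFunctional δ P v) + momFunctional δ P w := by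
  simp only [momFunctional, Pi.add_apply, Pi.smul_apply, Pi.sub_apply, smul_eq_mul, mul_add,
    mul_sub, Finset.sum_add_distrib, Finset.sum_sub_distrib, Finset.mul_sum]
  simp only [mul_left_comm]
  ring

lemma momFunctional_sub_smul_eLast {δ : ℕ} (hδ : 1 ≤ δ) (P : Polynomial ℝ) (r : ℝ)
    (x : Fin δ → ℝ) :
    momFunctional δ P (x - r • eLast δ) = momFunctional δ P x - r * P.coeff δ := by
  have h : ∑ i : Fin δ, P.coeff (i.1 + 1) * (r * eLast δ i) = r * P.coeff δ := by
    rw [Finset.sum_eq_single (⟨δ - 1, by omega⟩ : Fin δ)]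
    · simp [eLast, Nat.sub_add_cancel hδ, mul_comm]
    · intro i _ hi
      have : i.1 ≠ δ - 1 := fun h => hi (Fin.ext h)
      simp [eLast, this]
    · simp
  simp only [momFunctional, Pi.sub_apply, Pi.smul_apply, smul_eq_mul, mul_sub,
    Finset.sum_sub_distrib, h]
  ring

/-- The monic polynomial whose roots are the elements of `F`. -/
abbrev nodePoly (F : Finset ℕ) : Polynomial ℝ := Lagrange.nodal F (fun a : ℕ => (a : ℝ))

lemma natDegree_nodePoly (F : Finset ℕ) : (nodePoly F).natDegree = F.card :=
  Lagrange.natDegree_nodal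

lemma momFunctional_nodePoly_eq_zero {δ : ℕ} {F : Finset ℕ} (hF : F.card = δ) {x : Fin δ → ℝ}
    (hx : x ∈ affineSpan ℝ (momPts δ F)) : momFunctional δ (nodePoly F) x = 0 := by
  refine affineSpan_induction (p := fun x => momFunctional δ (nodePoly F) x = 0) hx ?_ ?_
  · rintro _ ⟨a, ha, rfl⟩
    rw [momFunctional_momCurve (by rw [natDegree_nodePoly, hF])]
    exact Lagrange.eval_nodal_at_node (v := fun a : ℕ => (a : ℝ)) ha
  · intro c u v w hu hv hw
    simp only [vsub_eq_sub, vadd_eq_add, momFunctional_add_smul_sub, hu, hv, hw]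
    simp

lemma sub_smul_eLast_mem_affineSpan {δ : ℕ} (hδ : 1 ≤ δ) {F : Finset ℕ} (hF : F.card = δ)
    (t : ℝ) :
    momCurve δ t - (nodePoly F).eval t • eLast δ ∈ affineSpan ℝ (momPts δ F) := by
  have hinj : Set.InjOn (fun a : ℕ => (a : ℝ)) F := Nat.cast_injective.injOn
  have hne : F.Nonempty := Finset.card_pos.mp (by omega)
  have key : ∀ P : Polynomial ℝ, P.degree < F.card →
      ∑ a ∈ F, (Lagrange.basis F (fun a : ℕ => (a : ℝ)) a).eval t * P.eval (a : ℝ) =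
        P.eval t := by
    intro P hP
    conv_rhs => rw [Lagrange.eq_interpolate hinj hP]
    simp [Lagrange.interpolate_apply, Polynomial.eval_finsetSum, mul_comm]
  have hsum : ∑ a ∈ F, (Lagrange.basis F (fun a : ℕ => (a : ℝ)) a).eval t = 1 := by
    rw [← Polynomial.eval_finsetSum, Lagrange.sum_basis hinj hne, Polynomial.eval_one]
  have hcomb : ∑ a ∈ F, (Lagrange.basis F (fun a : ℕ => (a : ℝ)) a).eval t • momCurve δ (a : ℝ) =
      momCurve δ t - (nodePoly F).eval t • eLast δ := by
    funext i
    simp only [Finset.sum_apply, Pi.smul_apply, smul_eq_mul, Pi.sub_apply, momCurve, eLast]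
    by_cases hi : i.1 = δ - 1
    · have hi' : i.1 + 1 = F.card := by omega
      have hdeg : (Polynomial.X ^ (i.1 + 1) - nodePoly F : Polynomial ℝ).degree < F.card := by
        have h := Polynomial.degree_sub_lt_left (p := (Polynomial.X ^ (i.1 + 1) : Polynomial ℝ))
          (q := nodePoly F)
          (by rw [Polynomial.degree_X_pow, Lagrange.degree_nodal, hi'])
          (by simp)
          (by rw [Polynomial.leadingCoeff_X_pow, Lagrange.nodal_monic.leadingCoeff])
        rw [Polynomial.degree_X_pow] at h
        exact h.trans_eq (congrArg _ hi')
      have h := key _ hdeg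
      simp only [Polynomial.eval_sub, Polynomial.eval_pow, Polynomial.eval_X] at h
      rw [if_pos hi, mul_one, ← h]
      refine Finset.sum_congr rfl fun a ha => ?_
      rw [Lagrange.eval_nodal_at_node (v := fun a : ℕ => (a : ℝ)) ha, sub_zero]
    · have h := key (Polynomial.X ^ (i.1 + 1)) (by
        rw [Polynomial.degree_X_pow]
        exact_mod_cast (by omega : i.1 + 1 < F.card))
      simp only [Polynomial.eval_pow, Polynomial.eval_X] at h
      rw [if_neg hi, mul_zero, sub_zero, h]
  rw [← hcomb, ← F.affineCombination_eq_linear_combination _ _ hsum]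
  refine affineSpan_mono ℝ ?_ (affineCombination_mem_affineSpan_image hsum
    (fun _ _ h => absurd ‹_› h) _ (s' := (F : Set ℕ)))
  rfl

lemma strictlyAbove_affineSpan_iff_s4 {δ : ℕ} (hδ : 1 ≤ δ) {F : Finset ℕ} (hF : F.card = δ)
    (t : ℝ) :
    StrictlyAbove (momCurve δ t)
      ((affineSpan ℝ (momPts δ F) : AffineSubspace ℝ (Fin δ → ℝ)) : Set (Fin δ → ℝ)) ↔
      0 < (nodePoly F).eval t := by
  constructor
  · rintro ⟨r, hr, h⟩
    have h0 := momFunctional_nodePoly_eq_zero hF h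
    have hc : (nodePoly F).coeff δ = 1 := by
      have := (Lagrange.nodal_monic (s := F) (v := fun a : ℕ => (a : ℝ))).coeff_natDegree
      rwa [natDegree_nodePoly, hF] at this
    rw [momFunctional_sub_smul_eLast hδ,
      momFunctional_momCurve (by rw [natDegree_nodePoly, hF]), hc] at h0
    linarith
  · exact fun h => ⟨_, h, sub_smul_eLast_mem_affineSpan hδ hF t⟩

lemma eval_nodePoly_pos_iff {F : Finset ℕ} {i : ℕ} (hi : i ∉ F) :
    0 < (nodePoly F).eval (i : ℝ) ↔ Even (F.filter (i < ·)).card := by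
  have hpos : 0 < (∏ f ∈ F.filter (i < ·), ((f : ℝ) - i)) *
      ∏ f ∈ F.filter (¬ i < ·), ((i : ℝ) - f) := by
    refine mul_pos (Finset.prod_pos fun f hf => ?_) (Finset.prod_pos fun f hf => ?_)
    · exact sub_pos.mpr (by exact_mod_cast (Finset.mem_filter.mp hf).2)
    · obtain ⟨hf, hle⟩ := Finset.mem_filter.mp hf
      have : f < i := lt_of_le_of_ne (not_lt.mp hle) (fun h => hi (h ▸ hf))
      exact sub_pos.mpr (by exact_mod_cast this)
  have heq : (nodePoly F).eval (i : ℝ) = (-1) ^ (F.filter (i < ·)).card *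
      ((∏ f ∈ F.filter (i < ·), ((f : ℝ) - i)) *
      ∏ f ∈ F.filter (¬ i < ·), ((i : ℝ) - f)) := by
    rw [Lagrange.eval_nodal, ← Finset.prod_filter_mul_prod_filter_not F (i < ·), ← mul_assoc,
      ← Finset.prod_const, ← Finset.prod_mul_distrib]
    simp
  rw [heq]
  rcases Nat.even_or_odd (F.filter (i < ·)).card with h | h
  · simpa only [h, h.neg_one_pow, one_mul, iff_true] using hpos
  · refine iff_of_false ?_ (Nat.not_even_iff_odd.mpr h)
    rw [h.neg_one_pow, neg_one_mul, neg_pos]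
    exact hpos.not_gt

/-- Gale's evenness criterion for lower facets. -/
lemma isLowerFacet_iff {m δ : ℕ} (hδ : 1 ≤ δ) (F : Finset ℕ) :
    IsLowerFacet m δ F ↔ F ⊆ Finset.Icc 1 m ∧ F.card = δ ∧
      ∀ i ∈ Finset.Icc 1 m, i ∉ F → Even (F.filter (i < ·)).card := by
  refine and_congr_right fun _ => and_congr_right fun hF => ?_
  refine forall_congr' fun i => forall_congr' fun _ => forall_congr' fun hi => ?_
  rw [strictlyAbove_affineSpan_iff_s4 hδ hF, eval_nodePoly_pos_iff hi]

lemma subset_of_smp_subset {δ : ℕ} {A F : Finset ℕ} (hF : F.card = δ)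
    (h : smp δ A ⊆ smp δ F) : A ⊆ F := by
  intro a ha
  have hmem : momCurve δ (a : ℝ) ∈ affineSpan ℝ (momPts δ F) :=
    convexHull_subset_affineSpan _ (h (subset_convexHull ℝ _ ⟨a, ha, rfl⟩))
  have h0 := momFunctional_nodePoly_eq_zero hF hmem
  rw [momFunctional_momCurve (by rw [natDegree_nodePoly, hF]), Lagrange.eval_nodal,
    Finset.prod_eq_zero_iff] at h0
  obtain ⟨f, hf, hfa⟩ := h0
  have : a = f := by exact_mod_cast sub_eq_zero.mp hfa
  exact this ▸ hf

lemma card_filter_lt_insert_pair {F : Finset ℕ} {x y i : ℕ} (hx : x ∉ F) (hy : y ∉ F)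
    (hxy : x < y) (hi : i < x ∨ y < i) (h : Even (F.filter (i < ·)).card) :
    Even ((insert x (insert y F)).filter (i < ·)).card := by
  rcases hi with hi | hi
  · rw [Finset.filter_insert, if_pos hi, Finset.filter_insert, if_pos (hi.trans hxy),
      Finset.card_insert_of_notMem (by simp [hx, hxy.ne]),
      Finset.card_insert_of_notMem (by simp [hy])]
    exact (h.add_one).add_one
  · rwa [Finset.filter_insert, if_neg (by omega), Finset.filter_insert, if_neg (by omega)]

/-- A set satisfying the evenness criterion extends by two elements, one of them prescribed. -/
lemma exists_even_extension {m : ℕ} {F : Finset ℕ} (hF : F ⊆ Finset.Icc 1 m)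
    (heven : ∀ i ∈ Finset.Icc 1 m, i ∉ F → Even (F.filter (i < ·)).card)
    (hcard : F.card + 2 ≤ m) {x : ℕ} (hx : x ∈ Finset.Icc 1 m) :
    ∃ G ⊆ Finset.Icc 1 m, insert x F ⊆ G ∧ G.card = F.card + 2 ∧
      ∀ i ∈ Finset.Icc 1 m, i ∉ G → Even (G.filter (i < ·)).card := by
  have hcompl : 2 ≤ (Finset.Icc 1 m \ F).card := by
    rw [Finset.card_sdiff_of_subset hF, Nat.card_Icc]
    omega
  wlog hxF : x ∉ F generalizing x
  · obtain ⟨z, hz⟩ : (Finset.Icc 1 m \ F).Nonempty := Finset.card_pos.mp (by omega)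
    obtain ⟨hz, hzF⟩ := Finset.mem_sdiff.mp hz
    obtain ⟨G, hG, hsub, h⟩ := this hz hzF
    refine ⟨G, hG, fun w hw => hsub ?_, h⟩
    grind
  suffices h : ∃ u v, u < v ∧ u ∈ Finset.Icc 1 m \ F ∧ v ∈ Finset.Icc 1 m \ F ∧
      (x = u ∨ x = v) ∧ ∀ i ∈ Finset.Icc 1 m \ F, i ≤ u ∨ v ≤ i by
    obtain ⟨u, v, huv, hu, hv, hxuv, hgap⟩ := h
    rw [Finset.mem_sdiff] at hu hv
    refine ⟨insert u (insert v F), ?_, ?_, ?_, fun i hi hiG => ?_⟩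
    · exact Finset.insert_subset hu.1 (Finset.insert_subset hv.1 hF)
    · grind
    · rw [Finset.card_insert_of_notMem (by simp [hu.2, huv.ne]),
        Finset.card_insert_of_notMem hv.2]
    · simp only [Finset.mem_insert, not_or] at hiG
      have := hgap i (Finset.mem_sdiff.mpr ⟨hi, hiG.2.2⟩)
      exact card_filter_lt_insert_pair hu.2 hv.2 huv (by omega) (heven i hi hiG.2.2)
  have hxm : x ∈ Finset.Icc 1 m \ F := Finset.mem_sdiff.mpr ⟨hx, hxF⟩
  rcases ((Finset.Icc 1 m \ F).filter (x < ·)).eq_empty_or_nonempty with he | hne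
  · obtain ⟨z, hz, hzx⟩ := Finset.exists_mem_ne (by omega : 1 < (Finset.Icc 1 m \ F).card) x
    have hmax : ∀ i ∈ Finset.Icc 1 m \ F, i ≤ x := fun i hi =>
      not_lt.mp fun h => Finset.filter_eq_empty_iff.mp he hi h
    have hne : ((Finset.Icc 1 m \ F).filter (· < x)).Nonempty :=
      ⟨z, Finset.mem_filter.mpr ⟨hz, lt_of_le_of_ne (hmax z hz) hzx⟩⟩
    obtain ⟨hu, hux⟩ := Finset.mem_filter.mp (Finset.max'_mem _ hne)
    refine ⟨_, x, hux, hu, hxm, Or.inr rfl, fun i hi => ?_⟩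
    by_cases h : i < x
    · exact Or.inl (Finset.le_max' _ _ (Finset.mem_filter.mpr ⟨hi, h⟩))
    · exact Or.inr (not_lt.mp h)
  · obtain ⟨hv, hxv⟩ := Finset.mem_filter.mp (Finset.min'_mem _ hne)
    refine ⟨x, _, hxv, hxm, hv, Or.inl rfl, fun i hi => ?_⟩
    by_cases h : x < i
    · exact Or.inr (Finset.min'_le _ _ (Finset.mem_filter.mpr ⟨hi, h⟩))
    · exact Or.inl (not_lt.mp h)

lemma exists_even_superset {m : ℕ} {F : Finset ℕ} (hF : F ⊆ Finset.Icc 1 m)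
    (heven : ∀ i ∈ Finset.Icc 1 m, i ∉ F → Even (F.filter (i < ·)).card)
    (B : Finset ℕ) (hB : B ⊆ Finset.Icc 1 m) (hcard : F.card + 2 * B.card ≤ m) :
    ∃ G ⊆ Finset.Icc 1 m, F ∪ B ⊆ G ∧ G.card = F.card + 2 * B.card ∧
      ∀ i ∈ Finset.Icc 1 m, i ∉ G → Even (G.filter (i < ·)).card := by
  induction B using Finset.induction_on with
  | empty => exact ⟨F, hF, by simp, by simp, heven⟩
  | insert x B hxB ih =>
    rw [Finset.card_insert_of_notMem hxB] at hcard ⊢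
    obtain ⟨hx, hB⟩ := Finset.insert_subset_iff.mp hB
    obtain ⟨G, hG, hsub, hGc, hGe⟩ := ih hB (by omega)
    obtain ⟨H, hH, hsub', hHc, hHe⟩ := exists_even_extension hG hGe (by omega) hx
    refine ⟨H, hH, ?_, by omega, hHe⟩
    rw [Finset.union_insert]
    exact (Finset.insert_subset_insert x hsub).trans hsub'

/-- If `F` has `2 d` elements and satisfies the evenness criterion, then every `d + 1` elements
of `F` include two consecutive integers. -/
lemma exists_consecutive_of_even {m d : ℕ} {F A : Finset ℕ} (hF : F ⊆ Finset.Icc 1 m)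
    (hFc : F.card = 2 * d)
    (heven : ∀ i ∈ Finset.Icc 1 m, i ∉ F → Even (F.filter (i < ·)).card)
    (hAF : A ⊆ F) (hA : d < A.card) : ∃ a ∈ A, a + 1 ∈ A := by
  have hmaps : ∀ a ∈ A, (F.filter (a < ·)).card / 2 ∈ Finset.range d := fun a ha => by
    have : (F.filter (a < ·)).card < F.card :=
      Finset.card_lt_card (Finset.filter_ssubset.mpr ⟨a, hAF ha, lt_irrefl a⟩)
    rw [Finset.mem_range]
    omega
  obtain ⟨a, ha, b, hb, hne, hab⟩ :=
    Finset.exists_ne_map_eq_of_card_lt_of_maps_to (by rwa [Finset.card_range]) hmaps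
  wlog hlt : a < b generalizing a b
  · exact this b hb a ha hne.symm hab.symm (by omega)
  have hins : insert b (F.filter (b < ·)) ⊆ F.filter (a < ·) := by
    have := hAF hb
    grind
  have hbc : (insert b (F.filter (b < ·))).card = (F.filter (b < ·)).card + 1 :=
    Finset.card_insert_of_notMem (by simp)
  have hle := Finset.card_le_card hins
  have heq := Finset.eq_of_subset_of_card_le hins (by omega)
  refine ⟨a, ha, ?_⟩
  by_contra hsucc
  have hb1 : b ≠ a + 1 := fun h => hsucc (h ▸ hb)
  have haF : a + 1 ∉ F := fun h => by
    have : a + 1 ∈ F.filter (a < ·) := Finset.mem_filter.mpr ⟨h, by omega⟩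
    rw [← heq, Finset.mem_insert, Finset.mem_filter] at this
    omega
  have hbm := Finset.mem_Icc.mp (hF (hAF hb))
  have hev := heven (a + 1) (Finset.mem_Icc.mpr ⟨by omega, by omega⟩) haF
  have hfilt : F.filter (a + 1 < ·) = F.filter (a < ·) := by
    refine Finset.filter_congr fun f hf => ?_
    have : f ≠ a + 1 := fun h => haF (h ▸ hf)
    omega
  rw [hfilt, Nat.even_iff] at hev
  omega

/-- `|A|_{2d}` lies in no lower facet of `C(m, 2d)` iff consecutive entries
of `A` differ by at least 2 (equivalently, `A` contains no two consecutive integers). -/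
theorem statement4 (d m : ℕ) (hd : 1 ≤ d) (hm : 2 * d + 1 ≤ m)
    (A : Finset ℕ) (hA : A ⊆ Finset.Icc 1 m) (hAc : A.card = d + 1) :
    (¬ ∃ F : Finset ℕ, IsLowerFacet m (2 * d) F ∧ smp (2 * d) A ⊆ smp (2 * d) F) ↔
      ∀ a ∈ A, a + 1 ∉ A := by
  constructor
  · intro h a ha ha1
    refine h ?_
    have hpair : ({a, a + 1} : Finset ℕ) ⊆ A := by
      simp [Finset.insert_subset_iff, ha, ha1]
    have hpc : ({a, a + 1} : Finset ℕ).card = 2 := Finset.card_pair (by omega)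
    have heven : ∀ i ∈ Finset.Icc 1 m, i ∉ ({a, a + 1} : Finset ℕ) →
        Even ((({a, a + 1} : Finset ℕ)).filter (i < ·)).card := by
      intro i _ hi
      simp only [Finset.mem_insert, Finset.mem_singleton, not_or] at hi
      exact card_filter_lt_insert_pair (F := ∅) (by simp) (by simp) (by omega) (by omega)
        (by simp)
    have hBc : (A \ {a, a + 1}).card = d - 1 := by
      rw [Finset.card_sdiff_of_subset hpair, hpc]
      omega
    obtain ⟨G, hG, hsub, hGc, hGe⟩ := exists_even_superset (hpair.trans hA) heven
      (A \ {a, a + 1}) (Finset.sdiff_subset.trans hA) (by omega)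
    rw [Finset.union_sdiff_of_subset hpair] at hsub
    refine ⟨G, (isLowerFacet_iff (by omega) G).mpr ⟨hG, by omega, hGe⟩, ?_⟩
    exact convexHull_mono (Set.image_mono (Finset.coe_subset.mpr hsub))
  · rintro h ⟨F, hF, hsub⟩
    obtain ⟨hFm, hFc, heven⟩ := (isLowerFacet_iff (by omega) F).mp hF
    obtain ⟨a, ha, ha1⟩ := exists_consecutive_of_even hFm hFc heven
      (subset_of_smp_subset hFc hsub) (by omega)
    exact h a ha ha1
end
end

section
/- Let d ≥ 1 and m ≥ 2d+1 be integers. Every triangulation of the cyclic polytope C(m, 2d) consists of exactly binomial(m−d−1, d) many (2d+1)-element subsets of {1, …, m}. -/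
open Finset

noncomputable section

/-- A point lies in `|A|_δ` iff it is a convex combination of the points `p_δ(a)`, `a ∈ A`. -/
theorem mem_smp_iff {δ : ℕ} {A : Finset ℕ} {y : Fin δ → ℝ} :
    y ∈ smp δ A ↔ ∃ w : ℕ → ℝ, (∀ a ∈ A, 0 ≤ w a) ∧ ∑ a ∈ A, w a = 1 ∧
      ∀ i : Fin δ, ∑ a ∈ A, w a * (a : ℝ) ^ (i.1 + 1) = y i := by
  constructor
  · intro hy
    refine convexHull_min (t := {y : Fin δ → ℝ | ∃ w : ℕ → ℝ, (∀ a ∈ A, 0 ≤ w a) ∧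
      ∑ a ∈ A, w a = 1 ∧ ∀ i : Fin δ, ∑ a ∈ A, w a * (a : ℝ) ^ (i.1 + 1) = y i}) ?_ ?_ hy
    · rintro _ ⟨a, ha, rfl⟩
      have ha' : a ∈ A := ha
      refine ⟨fun b => if b = a then 1 else 0, fun b _ => by positivity, ?_, fun i => ?_⟩
      · simp [ha']
      · simp [ha', momCurve]
    · rintro x ⟨w, hw, hw1, hwx⟩ z ⟨v, hv, hv1, hvz⟩ s t hs ht hst
      refine ⟨fun a => s * w a + t * v a, fun a ha => ?_, ?_, fun i => ?_⟩
      · exact add_nonneg (mul_nonneg hs (hw a ha)) (mul_nonneg ht (hv a ha))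
      · rw [sum_add_distrib, ← mul_sum, ← mul_sum, hw1, hv1]
        linarith
      · simp only [add_mul, sum_add_distrib, mul_assoc, ← mul_sum, hwx, hvz]
        simp
  · rintro ⟨w, hw, hw1, hwy⟩
    have hsum : ∑ a ∈ A, w a • momCurve δ (a : ℝ) = y := by
      ext i
      simpa [momCurve] using hwy i
    rw [← hsum]
    exact (convex_convexHull ℝ _).sum_mem hw hw1 fun a ha =>
      subset_convexHull ℝ _ ⟨a, ha, rfl⟩

/-- The weights `w` on `A` represent the linear functional
`P ↦ c * ∑ j ∈ J, P(j) + ε * [X^n] P` on polynomials of degree at most `n`. -/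
def Represents (n : ℕ) (A : Finset ℕ) (w : ℕ → ℝ) (J : Finset ℕ) (c ε : ℝ) : Prop :=
  ∀ P : Polynomial ℝ, P.natDegree ≤ n →
    ∑ a ∈ A, w a * P.eval (a : ℝ) = c * ∑ j ∈ J, P.eval (j : ℝ) + ε * P.coeff n

/-- The point `c * ∑ j ∈ J, p_n(j)`, pushed up by `ε` in the direction of the last coordinate. -/
def liftedPoint (n : ℕ) (J : Finset ℕ) (c ε : ℝ) : Fin n → ℝ :=
  fun i => c * ∑ j ∈ J, (j : ℝ) ^ (i.1 + 1) + ε * (if n = i.1 + 1 then 1 else 0)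

theorem liftedPoint_mem_smp_iff {n : ℕ} (hn : n ≠ 0) {A J : Finset ℕ} {c ε : ℝ}
    (hc : c * J.card = 1) :
    liftedPoint n J c ε ∈ smp n A ↔ ∃ w : ℕ → ℝ, (∀ a ∈ A, 0 ≤ w a) ∧ Represents n A w J c ε := by
  rw [mem_smp_iff]
  refine exists_congr fun w => and_congr_right fun _ => ⟨?_, ?_⟩
  · rintro ⟨h1, hi⟩ P hP
    have hmono : ∀ k < n + 1, ∑ a ∈ A, w a * (a : ℝ) ^ k
        = c * ∑ j ∈ J, (j : ℝ) ^ k + ε * (if n = k then 1 else 0) := by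
      intro k hk
      rcases k with _ | k
      · simp [h1, hc, hn]
      · exact hi ⟨k, by omega⟩
    have hsum : ∀ B : Finset ℕ, ∀ v : ℕ → ℝ, ∑ a ∈ B, v a * P.eval (a : ℝ)
        = ∑ k ∈ range (n + 1), P.coeff k * ∑ a ∈ B, v a * (a : ℝ) ^ k := by
      intro B v
      simp_rw [Polynomial.eval_eq_sum_range' (Nat.lt_succ_of_le hP), mul_sum]
      rw [sum_comm]
      exact sum_congr rfl fun _ _ => sum_congr rfl fun _ _ => by ring
    rw [hsum, sum_congr rfl fun k hk => by rw [hmono k (mem_range.1 hk)]]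
    simp only [mul_add, sum_add_distrib]
    congr 1
    · rw [mul_sum, hsum]
      simp only [mul_sum]
    · simp [mul_comm]
  · intro h
    refine ⟨?_, fun i => ?_⟩
    · have := h 1 (by simp)
      simpa [Polynomial.coeff_one, hn, hc] using this
    · have := h (Polynomial.X ^ (i.1 + 1)) (by rw [Polynomial.natDegree_X_pow]; omega)
      simpa [Polynomial.coeff_X_pow, liftedPoint] using this

/-- The monic polynomial `∏ b ∈ B, (X - b)`. -/
def rootPoly (B : Finset ℕ) : Polynomial ℝ := ∏ b ∈ B, (Polynomial.X - Polynomial.C (b : ℝ))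

theorem rootPoly_monic (B : Finset ℕ) : (rootPoly B).Monic :=
  Polynomial.monic_prod_of_monic _ _ fun _ _ => Polynomial.monic_X_sub_C _

theorem natDegree_rootPoly (B : Finset ℕ) : (rootPoly B).natDegree = B.card := by
  rw [rootPoly, Polynomial.natDegree_prod_of_monic _ _ fun _ _ => Polynomial.monic_X_sub_C _]
  simp only [Polynomial.natDegree_X_sub_C, sum_const, smul_eq_mul, mul_one]

theorem eval_rootPoly (B : Finset ℕ) (x : ℝ) : (rootPoly B).eval x = ∏ b ∈ B, (x - b) := by
  simp [rootPoly, Polynomial.eval_prod]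

theorem eval_rootPoly_eq_zero {B : Finset ℕ} {a : ℕ} (ha : a ∈ B) :
    (rootPoly B).eval (a : ℝ) = 0 := by
  rw [eval_rootPoly]
  exact prod_eq_zero ha (sub_self _)

theorem one_le_abs_eval_rootPoly {B : Finset ℕ} {a : ℕ} (ha : a ∉ B) :
    1 ≤ |(rootPoly B).eval (a : ℝ)| := by
  rw [eval_rootPoly]
  have hz : ∏ b ∈ B, ((a : ℤ) - b) ≠ 0 := by
    refine prod_ne_zero_iff.2 fun b hb h => ha ?_
    have : a = b := by omega
    rwa [this]
  exact_mod_cast Int.one_le_abs hz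

/-- The sign of `∏ b ∈ S \ {a}, (a - b)` is determined by the number of `b ∈ S` above `a`. -/
theorem eval_rootPoly_erase (S : Finset ℕ) (a : ℕ) :
    (rootPoly (S.erase a)).eval (a : ℝ)
      = (-1) ^ #{b ∈ S | a < b} * |(rootPoly (S.erase a)).eval (a : ℝ)| := by
  have hfilter : ({b ∈ S | a < b} : Finset ℕ) = {b ∈ S.erase a | a < b} := by
    ext b
    simp only [mem_filter, mem_erase]
    constructor
    · rintro ⟨h, h'⟩
      exact ⟨⟨h'.ne', h⟩, h'⟩
    · rintro ⟨⟨-, h⟩, h'⟩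
      exact ⟨h, h'⟩
  rw [eval_rootPoly, abs_prod, hfilter, ← prod_const, prod_filter, ← prod_mul_distrib]
  refine prod_congr rfl fun b _ => ?_
  split_ifs with h
  · have : (a : ℝ) < b := by exact_mod_cast h
    rw [abs_of_neg (by linarith)]
    ring
  · have : (b : ℝ) ≤ a := by exact_mod_cast not_lt.1 h
    rw [abs_of_nonneg (by linarith), one_mul]

/-- The elements of `S` with an odd number of elements of `S` above them. -/
def oddPart (S : Finset ℕ) : Finset ℕ := {a ∈ S | Odd #{b ∈ S | a < b}}

theorem oddPart_subset (S : Finset ℕ) : oddPart S ⊆ S := filter_subset _ _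

theorem eval_rootPoly_erase_pos {S : Finset ℕ} {a : ℕ} (ha : a ∈ S) (h : a ∉ oddPart S) :
    0 < (rootPoly (S.erase a)).eval (a : ℝ) := by
  have heven : Even #{b ∈ S | a < b} := by
    simpa [oddPart, ha] using h
  have := one_le_abs_eval_rootPoly (notMem_erase a S)
  rw [eval_rootPoly_erase, heven.neg_one_pow]
  linarith

theorem eval_rootPoly_erase_neg {S : Finset ℕ} {a : ℕ} (h : a ∈ oddPart S) :
    (rootPoly (S.erase a)).eval (a : ℝ) < 0 := by
  have hodd : Odd #{b ∈ S | a < b} := (mem_filter.1 h).2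
  have := one_le_abs_eval_rootPoly (notMem_erase a S)
  rw [eval_rootPoly_erase, hodd.neg_one_pow]
  linarith

theorem card_oddPart (S : Finset ℕ) : #(oddPart S) = #S / 2 := by
  induction S using Finset.induction_on_min with
  | empty => simp [oddPart]
  | insert a S ha ih =>
    have haS : a ∉ S := fun h => lt_irrefl _ (ha a h)
    have hS : ∀ x ∈ S, #{b ∈ insert a S | x < b} = #{b ∈ S | x < b} := by
      intro x hx
      rw [filter_insert, if_neg (ha x hx).not_gt]
    have ha' : #{b ∈ insert a S | a < b} = #S := by
      rw [filter_insert, if_neg (lt_irrefl a), filter_true_of_mem ha]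
    have hodd : ({x ∈ S | Odd #{b ∈ insert a S | x < b}} : Finset ℕ) = oddPart S :=
      filter_congr fun x hx => by rw [hS x hx]
    rw [oddPart, filter_insert, ha', hodd, card_insert_of_notMem haS]
    have haO : a ∉ oddPart S := fun h => haS (oddPart_subset S h)
    split_ifs with h
    · rw [card_insert_of_notMem haO, ih]
      obtain ⟨k, hk⟩ := h
      omega
    · rw [ih]
      obtain ⟨k, hk⟩ := Nat.not_odd_iff_even.1 h
      omega

/-- The `d`-element subsets of `{k, …, k + n - 1}` without two consecutive elements. -/
def sparseSets (k n d : ℕ) : Finset (Finset ℕ) :=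
  {J ∈ powersetCard d (Ico k (k + n)) | ∀ j ∈ J, j + 1 ∉ J}

theorem mem_sparseSets {k n d : ℕ} {J : Finset ℕ} :
    J ∈ sparseSets k n d ↔ (∀ j ∈ J, k ≤ j ∧ j < k + n) ∧ #J = d ∧ ∀ j ∈ J, j + 1 ∉ J := by
  simp [sparseSets, mem_powersetCard, subset_iff, and_assoc]

theorem sparseSets_succ_succ (k n d : ℕ) :
    sparseSets k (n + 2) (d + 1) = sparseSets k (n + 1) (d + 1) ∪
      (sparseSets k n d).image (insert (k + n + 1)) := by
  ext J
  simp only [mem_union, mem_image, mem_sparseSets]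
  constructor
  · rintro ⟨hJ, hc, hs⟩
    by_cases h : k + n + 1 ∈ J
    · refine Or.inr ⟨J.erase (k + n + 1), ⟨fun j hj => ?_, ?_, fun j hj hj' => ?_⟩,
        insert_erase h⟩
      · have hj1 := mem_erase.1 hj
        have h1 := hJ j hj1.2
        have h2 : j ≠ k + n := fun h' => hs j hj1.2 (h' ▸ h)
        have h3 := hj1.1
        omega
      · rw [card_erase_of_mem h, hc]
        rfl
      · exact hs j (mem_of_mem_erase hj) (mem_of_mem_erase hj')
    · refine Or.inl ⟨fun j hj => ?_, hc, hs⟩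
      have h1 := hJ j hj
      have h2 : j ≠ k + n + 1 := fun h' => h (h' ▸ hj)
      omega
  · rintro (⟨hJ, hc, hs⟩ | ⟨K, ⟨hK, hc, hs⟩, rfl⟩)
    · exact ⟨fun j hj => ⟨(hJ j hj).1, by have := (hJ j hj).2; omega⟩, hc, hs⟩
    · have hn : k + n + 1 ∉ K := fun h => by have := (hK _ h).2; omega
      refine ⟨fun j hj => ?_, by rw [card_insert_of_notMem hn, hc], fun j hj hj' => ?_⟩
      · rcases mem_insert.1 hj with rfl | hj
        · omega
        · have := hK j hj
          omega
      · rcases mem_insert.1 hj with rfl | hj <;> rcases mem_insert.1 hj' with h' | hj'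
        · omega
        · have := hK _ hj'
          omega
        · have := hK _ hj
          omega
        · exact hs j hj hj'

theorem card_sparseSets (k n d : ℕ) : #(sparseSets k n d) = (n + 1 - d).choose d := by
  induction n using Nat.strong_induction_on generalizing d with
  | _ n ih =>
    rcases d with _ | d
    · have : sparseSets k n 0 = {∅} := by
        ext J
        rw [mem_sparseSets, mem_singleton, card_eq_zero]
        constructor
        · exact fun h => h.2.1
        · rintro rfl
          simp
      simp [this]
    rcases n with _ | _ | n
    · have : sparseSets k 0 (d + 1) = ∅ := by simp [sparseSets]
      rw [this, card_empty, Nat.choose_eq_zero_of_lt (by omega)]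
    · rcases d with _ | d
      · have : sparseSets k 1 1 = {{k}} := by
          ext J
          rw [mem_sparseSets, mem_singleton]
          constructor
          · rintro ⟨hJ, hc, -⟩
            obtain ⟨j, rfl⟩ := card_eq_one.1 hc
            have := hJ j (mem_singleton_self j)
            rw [show j = k by omega]
          · rintro rfl
            simp
        simp [this]
      · have : sparseSets k 1 (d + 1 + 1) = ∅ := by simp [sparseSets]
        simp [this]
    · have hdisj : Disjoint (sparseSets k (n + 1) (d + 1))
          ((sparseSets k n d).image (insert (k + n + 1))) := by
        rw [disjoint_left]
        rintro J hJ hJ'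
        obtain ⟨K, -, rfl⟩ := mem_image.1 hJ'
        have := ((mem_sparseSets.1 hJ).1 _ (mem_insert_self _ _)).2
        omega
      have hinj : Set.InjOn (insert (k + n + 1)) (sparseSets k n d : Set (Finset ℕ)) := by
        intro K hK K' hK' h
        have hnot : ∀ L ∈ sparseSets k n d, k + n + 1 ∉ L := fun L hL h => by
          have := ((mem_sparseSets.1 hL).1 _ h).2
          omega
        rw [← erase_insert (hnot K hK), ← erase_insert (hnot K' hK')]
        exact congrArg (fun L => erase L (k + n + 1)) h
      rw [sparseSets_succ_succ, card_union_of_disjoint hdisj, card_image_of_injOn hinj,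
        ih (n + 1) (by omega), ih n (by omega)]
      rcases le_or_gt d (n + 1) with h | h
      · rw [show n + 1 + 1 + 1 - (d + 1) = n + 1 - d + 1 by omega,
          show n + 1 + 1 - (d + 1) = n + 1 - d by omega, Nat.choose_succ_succ', add_comm]
      · rw [Nat.choose_eq_zero_of_lt (by omega), Nat.choose_eq_zero_of_lt (by omega),
          Nat.choose_eq_zero_of_lt (by omega)]

theorem oddPart_mem_sparseSets {d m : ℕ} {S : Finset ℕ} (hS : S ⊆ Icc 1 m)
    (hc : #S = 2 * d + 1) : oddPart S ∈ sparseSets 2 (m - 2) d := by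
  refine mem_sparseSets.2 ⟨fun j hj => ?_, by rw [card_oddPart, hc]; omega, fun j hj hj' => ?_⟩
  · obtain ⟨hjS, hodd⟩ := mem_filter.1 hj
    have hj1 := mem_Icc.1 (hS hjS)
    obtain ⟨b, hb⟩ := card_pos.1 hodd.pos
    obtain ⟨hbS, hjb⟩ := mem_filter.1 hb
    have hb1 := mem_Icc.1 (hS hbS)
    have hne : j ≠ 1 := by
      rintro rfl
      have : ({b ∈ S | 1 < b} : Finset ℕ) = S.erase 1 := by
        ext b
        simp only [mem_filter, mem_erase]
        constructor
        · rintro ⟨h, h'⟩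
          exact ⟨h'.ne', h⟩
        · rintro ⟨h, h'⟩
          have := mem_Icc.1 (hS h')
          exact ⟨h', by omega⟩
      rw [this, card_erase_of_mem hjS, hc] at hodd
      obtain ⟨k, hk⟩ := hodd
      omega
    omega
  · obtain ⟨hjS, hodd⟩ := mem_filter.1 hj
    obtain ⟨hjS', hodd'⟩ := mem_filter.1 hj'
    have : ({b ∈ S | j < b} : Finset ℕ) = insert (j + 1) {b ∈ S | j + 1 < b} := by
      ext b
      simp only [mem_filter, mem_insert]
      constructor
      · rintro ⟨h, h'⟩
        rcases eq_or_ne b (j + 1) with h1 | h1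
        · exact Or.inl h1
        · exact Or.inr ⟨h, by omega⟩
      · rintro (rfl | ⟨h, h'⟩)
        · exact ⟨hjS', by omega⟩
        · exact ⟨h, by omega⟩
    rw [this, card_insert_of_notMem (by simp)] at hodd
    obtain ⟨k, hk⟩ := hodd
    obtain ⟨l, hl⟩ := hodd'
    omega

/-- Every sparse set `J` arises as the odd part of the simplex `{1} ∪ J ∪ (J + 1)`. -/
theorem exists_oddPart_subset {d m : ℕ} {J : Finset ℕ} (hm : 2 ≤ m)
    (hJ : J ∈ sparseSets 2 (m - 2) d) :
    ∃ S ⊆ Icc 1 m, #S = 2 * d + 1 ∧ J ⊆ S ∧ oddPart S ⊆ J := by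
  obtain ⟨hJ, hc, hs⟩ := mem_sparseSets.1 hJ
  have hcard : ∀ A ⊆ J, #(A ∪ A.image (· + 1)) = 2 * #A := by
    intro A hA
    rw [card_union_of_disjoint, card_image_of_injective _ (add_left_injective 1), two_mul]
    rw [disjoint_left]
    intro a ha ha'
    obtain ⟨b, hb, rfl⟩ := mem_image.1 ha'
    exact hs b (hA hb) (hA ha)
  have h1 : 1 ∉ J ∪ J.image (· + 1) := by
    intro h
    rcases mem_union.1 h with h | h
    · have := hJ 1 h
      omega
    · obtain ⟨b, hb, h⟩ := mem_image.1 h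
      have := hJ b hb
      omega
  refine ⟨insert 1 (J ∪ J.image (· + 1)), ?_, ?_, ?_, ?_⟩
  · intro a ha
    rw [mem_Icc]
    simp only [mem_insert, mem_union, mem_image] at ha
    rcases ha with rfl | ha | ⟨b, hb, rfl⟩
    · omega
    · have := hJ a ha
      omega
    · have := hJ b hb
      omega
  · rw [card_insert_of_notMem h1, hcard J subset_rfl, hc]
  · exact subset_union_left.trans (subset_insert _ _)
  · intro a ha
    obtain ⟨haS, hodd⟩ := mem_filter.1 ha
    by_contra haJ
    have heven : ({b ∈ insert 1 (J ∪ J.image (· + 1)) | a < b} : Finset ℕ)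
        = {b ∈ J | a < b} ∪ ({b ∈ J | a < b}).image (· + 1) := by
      ext b
      simp only [mem_filter, mem_union, mem_image, mem_insert] at haS ⊢
      constructor
      · rintro ⟨rfl | hb | ⟨c, hb, rfl⟩, hab⟩
        · rcases haS with rfl | h | ⟨c, h, rfl⟩
          · omega
          · exact absurd h haJ
          · omega
        · exact Or.inl ⟨hb, hab⟩
        · refine Or.inr ⟨c, ⟨hb, ?_⟩, rfl⟩
          have : a ≠ c := fun h => haJ (h ▸ hb)
          omega
      · rintro (⟨hb, hab⟩ | ⟨c, ⟨hb, hab⟩, rfl⟩)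
        · exact ⟨Or.inr (Or.inl hb), hab⟩
        · exact ⟨Or.inr (Or.inr ⟨c, hb, rfl⟩), by omega⟩
    rw [heven, hcard _ (filter_subset _ _)] at hodd
    obtain ⟨k, hk⟩ := hodd
    omega

/-- If `oddPart S ⊆ J ⊆ S`, then pushing the barycenter of `J` slightly upwards gives a point
in the interior of the simplex `S`. -/
theorem exists_pos_represents {n : ℕ} {S J : Finset ℕ} {c ε : ℝ} (hS : #S = n + 1)
    (hJS : J ⊆ S) (hSJ : oddPart S ⊆ J) (hε : 0 < ε) (hεc : ε < c) :
    ∃ w : ℕ → ℝ, (∀ a ∈ S, 0 < w a) ∧ Represents n S w J c ε := by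
  refine ⟨fun a => (if a ∈ J then c else 0) + ε / (rootPoly (S.erase a)).eval (a : ℝ),
    fun a ha => ?_, fun P hP => ?_⟩
  · dsimp only
    split_ifs with h
    · have h1 := one_le_abs_eval_rootPoly (notMem_erase a S)
      have h2 : |ε / (rootPoly (S.erase a)).eval (a : ℝ)| ≤ ε := by
        rw [abs_div, abs_of_pos hε]
        exact div_le_self hε.le h1
      have := neg_abs_le (ε / (rootPoly (S.erase a)).eval (a : ℝ))
      linarith
    · rw [zero_add]
      exact div_pos hε (eval_rootPoly_erase_pos ha fun h' => h (hSJ h'))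
  · have hdeg : P.degree < #S := by
      refine lt_of_le_of_lt (Polynomial.degree_le_of_natDegree_le hP) ?_
      rw [hS]
      exact_mod_cast Nat.lt_succ_self n
    have hcoeff := Lagrange.coeff_eq_sum (s := S) (v := fun a : ℕ => (a : ℝ))
      (Nat.cast_injective.injOn) hdeg
    rw [hS, Nat.add_sub_cancel] at hcoeff
    simp only [add_mul, sum_add_distrib]
    congr 1
    · simp only [ite_mul, zero_mul]
      rw [← sum_filter, filter_mem_eq_inter, inter_eq_right.2 hJS, mul_sum]
    · rw [hcoeff, mul_sum]
      refine sum_congr rfl fun a _ => ?_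
      rw [eval_rootPoly]
      ring

theorem subset_of_represents {d : ℕ} {S J : Finset ℕ} {w : ℕ → ℝ} {c ε : ℝ} (hJ : #J = d)
    (hw : ∀ a ∈ S, 0 ≤ w a) (hε : 0 < ε) (hεc : ε < c) (h : Represents (2 * d) S w J c ε) :
    J ⊆ S := by
  intro j hj
  by_contra hjS
  have hdP : (rootPoly (J.erase j) ^ 2).natDegree = 2 * (d - 1) := by
    rw [(rootPoly_monic _).natDegree_pow, natDegree_rootPoly, card_erase_of_mem hj, hJ]
  have hdQ : (rootPoly J ^ 2).natDegree = 2 * d := by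
    rw [(rootPoly_monic _).natDegree_pow, natDegree_rootPoly, hJ]
  have hd : 0 < d := hJ ▸ card_pos.2 ⟨j, hj⟩
  have hP := h (rootPoly (J.erase j) ^ 2) (by omega)
  have hQ := h (rootPoly J ^ 2) hdQ.le
  rw [Polynomial.coeff_eq_zero_of_natDegree_lt (by omega), mul_zero, add_zero,
    sum_eq_single_of_mem j hj fun b hb hbj => by
      rw [Polynomial.eval_pow, eval_rootPoly_eq_zero (mem_erase.2 ⟨hbj, hb⟩)]
      simp] at hP
  rw [sum_eq_zero (s := J) fun b hb => by
      rw [Polynomial.eval_pow, eval_rootPoly_eq_zero hb]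
      simp, mul_zero, zero_add, ← hdQ,
    ((rootPoly_monic J).pow 2).coeff_natDegree, mul_one] at hQ
  have hle : ∑ a ∈ S, w a * (rootPoly (J.erase j) ^ 2).eval (a : ℝ)
      ≤ ∑ a ∈ S, w a * (rootPoly J ^ 2).eval (a : ℝ) := by
    refine sum_le_sum fun a ha => mul_le_mul_of_nonneg_left ?_ (hw a ha)
    have haj : a ∉ ({j} : Finset ℕ) := fun h' => hjS (mem_singleton.1 h' ▸ ha)
    have h1 := one_le_abs_eval_rootPoly haj
    rw [eval_rootPoly, prod_singleton] at h1
    have h2 : (1 : ℝ) ≤ ((a : ℝ) - j) ^ 2 := by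
      rw [← sq_abs]
      nlinarith
    rw [Polynomial.eval_pow, Polynomial.eval_pow, eval_rootPoly, eval_rootPoly,
      ← mul_prod_erase J _ hj, mul_pow]
    exact le_mul_of_one_le_left (sq_nonneg _) h2
  have h1 := one_le_abs_eval_rootPoly (notMem_erase j J)
  have h2 : 1 ≤ (rootPoly (J.erase j) ^ 2).eval (j : ℝ) := by
    rw [Polynomial.eval_pow, ← sq_abs]
    nlinarith
  have h3 : c ≤ c * (rootPoly (J.erase j) ^ 2).eval (j : ℝ) :=
    le_mul_of_one_le_right (hε.trans hεc).le h2
  linarith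

theorem oddPart_subset_of_represents {n : ℕ} {S J : Finset ℕ} {w : ℕ → ℝ} {c ε : ℝ}
    (hS : #S = n + 1) (hJS : J ⊆ S) (hw : ∀ a ∈ S, 0 ≤ w a) (hε : 0 < ε)
    (h : Represents n S w J c ε) : oddPart S ⊆ J := by
  intro a ha
  by_contra haJ
  have haS := oddPart_subset S ha
  have hdeg : (rootPoly (S.erase a)).natDegree = n := by
    rw [natDegree_rootPoly, card_erase_of_mem haS, hS, Nat.add_sub_cancel]
  have hP := h (rootPoly (S.erase a)) hdeg.le
  have hcoeff : (rootPoly (S.erase a)).coeff n = 1 := by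
    have := (rootPoly_monic (S.erase a)).coeff_natDegree
    rwa [hdeg] at this
  rw [hcoeff, sum_eq_single_of_mem a haS fun b hb hba => by
      rw [eval_rootPoly_eq_zero (mem_erase.2 ⟨hba, hb⟩), mul_zero],
    sum_eq_zero fun b hb => eval_rootPoly_eq_zero
      (mem_erase.2 ⟨ne_of_mem_of_not_mem hb haJ, hJS hb⟩)] at hP
  have := mul_nonpos_of_nonneg_of_nonpos (hw a haS) (eval_rootPoly_erase_neg ha).le
  linarith

/-- A functional with positive weights on a simplex `S` is represented on no proper subset
of `S`. -/
theorem subset_of_represents_inter {n : ℕ} {S S' J : Finset ℕ} {w w' : ℕ → ℝ} {c ε : ℝ}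
    (hS : #S = n + 1) (hw : ∀ a ∈ S, 0 < w a) (h : Represents n S w J c ε)
    (h' : Represents n (S ∩ S') w' J c ε) : S ⊆ S' := by
  intro a ha
  by_contra haS'
  have hdeg : (rootPoly (S.erase a)).natDegree ≤ n := by
    rw [natDegree_rootPoly, card_erase_of_mem ha, hS, Nat.add_sub_cancel]
  have heq := (h _ hdeg).trans (h' _ hdeg).symm
  rw [sum_eq_single_of_mem a ha fun b hb hba => by
      rw [eval_rootPoly_eq_zero (mem_erase.2 ⟨hba, hb⟩), mul_zero],
    sum_eq_zero (s := S ∩ S') fun b hb => by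
      have hb := mem_inter.1 hb
      rw [eval_rootPoly_eq_zero (mem_erase.2 ⟨ne_of_mem_of_not_mem hb.2 haS', hb.1⟩), mul_zero]] at heq
  have h1 := one_le_abs_eval_rootPoly (notMem_erase a S)
  rcases mul_eq_zero.1 heq with h0 | h0
  · exact (hw a ha).ne' h0
  · rw [h0, abs_zero] at h1
    linarith

theorem injOn_oddPart {d m : ℕ} (hd : 1 ≤ d) {T : Finset (Finset ℕ)}
    (hT : IsTriangulation m (2 * d) T) : Set.InjOn oddPart (T : Set (Finset ℕ)) := by
  intro S hS S' hS' h
  obtain ⟨hTc, -, hTi⟩ := hT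
  have hcS := (hTc S hS).2
  have hcS' := (hTc S' hS').2
  have hJ : #(oddPart S) = d := by rw [card_oddPart, hcS]; omega
  have hd0 : (0 : ℝ) < d := by exact_mod_cast hd
  have hc : (d : ℝ)⁻¹ * #(oddPart S) = 1 := by rw [hJ, inv_mul_cancel₀ hd0.ne']
  have hc0 : (0 : ℝ) < (d : ℝ)⁻¹ := inv_pos.2 hd0
  obtain ⟨w, hw, hr⟩ := exists_pos_represents (c := (d : ℝ)⁻¹) hcS (oddPart_subset S) subset_rfl
    (half_pos hc0) (half_lt_self hc0)
  obtain ⟨w', hw', hr'⟩ := exists_pos_represents (c := (d : ℝ)⁻¹) hcS' (oddPart_subset S')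
    subset_rfl (half_pos hc0) (half_lt_self hc0)
  rw [← h] at hr'
  have hn : 2 * d ≠ 0 := by omega
  have hmem : liftedPoint (2 * d) (oddPart S) (d : ℝ)⁻¹ ((d : ℝ)⁻¹ / 2)
      ∈ smp (2 * d) S ∩ smp (2 * d) S' :=
    ⟨(liftedPoint_mem_smp_iff hn hc).2 ⟨w, fun a ha => (hw a ha).le, hr⟩,
      (liftedPoint_mem_smp_iff hn hc).2 ⟨w', fun a ha => (hw' a ha).le, hr'⟩⟩
  rw [hTi S hS S' hS'] at hmem
  obtain ⟨v, -, hv⟩ := (liftedPoint_mem_smp_iff hn hc).1 hmem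
  exact eq_of_subset_of_card_le (subset_of_represents_inter hcS hw hr hv) (by rw [hcS, hcS'])

theorem exists_oddPart_eq {d m : ℕ} (hd : 1 ≤ d) (hm : 2 ≤ m) {T : Finset (Finset ℕ)}
    (hT : IsTriangulation m (2 * d) T) {J : Finset ℕ} (hJ : J ∈ sparseSets 2 (m - 2) d) :
    ∃ S ∈ T, oddPart S = J := by
  obtain ⟨hTc, hTu, -⟩ := hT
  have hJc : #J = d := (mem_sparseSets.1 hJ).2.1
  have hd0 : (0 : ℝ) < d := by exact_mod_cast hd
  have hc : (d : ℝ)⁻¹ * #J = 1 := by rw [hJc, inv_mul_cancel₀ hd0.ne']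
  have hc0 : (0 : ℝ) < (d : ℝ)⁻¹ := inv_pos.2 hd0
  have hn : 2 * d ≠ 0 := by omega
  obtain ⟨S₀, hS₀, hcS₀, hJS₀, hS₀J⟩ := exists_oddPart_subset hm hJ
  obtain ⟨w, hw, hr⟩ := exists_pos_represents (c := (d : ℝ)⁻¹) hcS₀ hJS₀ hS₀J
    (half_pos hc0) (half_lt_self hc0)
  have hmem : liftedPoint (2 * d) J (d : ℝ)⁻¹ ((d : ℝ)⁻¹ / 2) ∈ cyc m (2 * d) :=
    convexHull_mono (Set.image_mono (coe_subset.2 hS₀))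
      ((liftedPoint_mem_smp_iff hn hc).2 ⟨w, fun a ha => (hw a ha).le, hr⟩)
  rw [← hTu] at hmem
  obtain ⟨S, hS, hmemS⟩ := Set.mem_iUnion₂.1 hmem
  obtain ⟨v, hv, hvr⟩ := (liftedPoint_mem_smp_iff hn hc).1 hmemS
  have hcS := (hTc S hS).2
  have hJS := subset_of_represents hJc hv (half_pos hc0) (half_lt_self hc0) hvr
  refine ⟨S, hS, eq_of_subset_of_card_le
    (oddPart_subset_of_represents hcS hJS hv (half_pos hc0) hvr) ?_⟩
  rw [card_oddPart, hcS, hJc]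
  omega

/-- every triangulation of `C(m, 2d)` has exactly `(m - d - 1).choose d`
maximal simplices. -/
theorem statement6 (d m : ℕ) (hd : 1 ≤ d) (hm : 2 * d + 1 ≤ m)
    (T : Finset (Finset ℕ)) (hT : IsTriangulation m (2 * d) T) :
    T.card = (m - d - 1).choose d := by
  have himage : T.image oddPart = sparseSets 2 (m - 2) d := by
    ext J
    rw [mem_image]
    constructor
    · rintro ⟨S, hS, rfl⟩
      exact oddPart_mem_sparseSets (hT.1 S hS).1 (hT.1 S hS).2
    · exact exists_oddPart_eq hd (by omega) hT
  rw [← card_image_of_injOn (injOn_oddPart hd hT), himage, card_sparseSets]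
  congr 1
  omega
end
end
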